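/- Saturated propagator of general higher-derivative 3D gravity: let σ, α, β, κ, Λ be reals with σ ≠ 0, β ≠ 0, 8α + 3β ≠ 0, κ ≠ 0, Λ ≠ 0, set m₂² := −4σ/(βκ²) and m₀² := 4σ/((8α+3β)κ²), and let k ∈ ℝ³ satisfy k² ∉ {0, m₂², m₀²}. Then for every conserved symmetric current T^{μν} (k_μT^{μν} = 0), the saturated propagator SP := T^{μν}(𝒪⁻¹)_{μν,κλ}T^{κλ} equals (1/σ)[1/k² − 1/(k² − m₂²)](T_{μν}T^{μν} − ½T²) + (1/σ)[−1/k² + 1/(k² − m₀²)]·½T². -/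

import Mathlib

open BigOperators Topology Filter

noncomputable section

/-- The 3D Minkowski metric η = diag(1, -1, -1). -/
def eta : Fin 3 → Fin 3 → ℝ :=
  fun μ ν => if μ = ν then (if μ = 0 then 1 else -1) else 0

/-- Lowered index: k_μ = η_{μν} k^ν. -/
def lowerIdx (k : Fin 3 → ℝ) (μ : Fin 3) : ℝ := ∑ ν, eta μ ν * k ν

/-- Minkowski square k² = η_{μν} k^μ k^ν. -/
def ksq (k : Fin 3 → ℝ) : ℝ := ∑ μ, ∑ ν, eta μ ν * k μ * k ν

/-- Transverse projector θ_{μν} = η_{μν} - k_μ k_ν / k². -/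
def θt (k : Fin 3 → ℝ) (μ ν : Fin 3) : ℝ :=
  eta μ ν - lowerIdx k μ * lowerIdx k ν / ksq k

/-- Longitudinal projector ω_{μν} = k_μ k_ν / k². -/
def ωt (k : Fin 3 → ℝ) (μ ν : Fin 3) : ℝ :=
  lowerIdx k μ * lowerIdx k ν / ksq k

/-- Rank-4 tensors (operators on symmetric rank-2 tensors), all indices down. -/
abbrev Tensor4 := Fin 3 → Fin 3 → Fin 3 → Fin 3 → ℝ

/-- Barnes–Rivers spin-2 projector. -/
def P2 (k : Fin 3 → ℝ) : Tensor4 := fun μ ν κ lam =>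
  (1/2) * (θt k μ κ * θt k ν lam + θt k μ lam * θt k ν κ - θt k μ ν * θt k κ lam)

/-- Barnes–Rivers spin-1 projector. -/
def P1 (k : Fin 3 → ℝ) : Tensor4 := fun μ ν κ lam =>
  (1/2) * (θt k μ κ * ωt k ν lam + θt k μ lam * ωt k ν κ +
           θt k ν lam * ωt k μ κ + θt k ν κ * ωt k μ lam)

/-- Barnes–Rivers spin-0 (s) projector. -/
def P0s (k : Fin 3 → ℝ) : Tensor4 := fun μ ν κ lam =>
  (1/2) * (θt k μ ν * θt k κ lam)

/-- Barnes–Rivers spin-0 (w) projector. -/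
def P0w (k : Fin 3 → ℝ) : Tensor4 := fun μ ν κ lam =>
  ωt k μ ν * ωt k κ lam

/-- Barnes–Rivers transfer operator P^{(0-sw)}. -/
def P0sw (k : Fin 3 → ℝ) : Tensor4 := fun μ ν κ lam =>
  (1 / Real.sqrt 2) * (θt k μ ν * ωt k κ lam)

/-- Barnes–Rivers transfer operator P^{(0-ws)}. -/
def P0ws (k : Fin 3 → ℝ) : Tensor4 := fun μ ν κ lam =>
  (1 / Real.sqrt 2) * (ωt k μ ν * θt k κ lam)

/-- Contraction product (A·B)_{μν,κλ} = A_{μν}{}^{ρσ} B_{ρσ,κλ}, indices raised with η. -/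
def bprod (A B : Tensor4) : Tensor4 := fun μ ν κ lam =>
  ∑ ρ, ∑ σ, ∑ ρ', ∑ σ', A μ ν ρ σ * eta ρ ρ' * eta σ σ' * B ρ' σ' κ lam

/-- Saturation T^{μν} P_{μν,κλ} T^{κλ} of a rank-4 operator with a current. -/
def satur (P : Tensor4) (T : Fin 3 → Fin 3 → ℝ) : ℝ :=
  ∑ μ, ∑ ν, ∑ κ, ∑ lam, T μ ν * P μ ν κ lam * T κ lam

/-- Trace T = η_{μν} T^{μν}. -/
def trT (T : Fin 3 → Fin 3 → ℝ) : ℝ := ∑ μ, ∑ ν, eta μ ν * T μ ν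

/-- Square T_{μν}T^{μν} = η_{μα} η_{νβ} T^{αβ} T^{μν}. -/
def Tsq (T : Fin 3 → Fin 3 → ℝ) : ℝ :=
  ∑ μ, ∑ ν, ∑ α, ∑ β, eta μ α * eta ν β * T α β * T μ ν

theorem satur_add (P Q : Tensor4) (T : Fin 3 → Fin 3 → ℝ) :
    satur (P + Q) T = satur P T + satur Q T := by
  simp only [satur, Pi.add_apply, mul_add, add_mul, Finset.sum_add_distrib]

theorem satur_smul (c : ℝ) (P : Tensor4) (T : Fin 3 → Fin 3 → ℝ) :
    satur (c • P) T = c * satur P T := by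
  simp only [satur, Pi.smul_apply, smul_eq_mul, Finset.mul_sum]
  refine Finset.sum_congr rfl fun μ _ => Finset.sum_congr rfl fun ν _ =>
    Finset.sum_congr rfl fun κ _ => Finset.sum_congr rfl fun l _ => ?_
  ring

/-- Saturating an outer product of two rank-2 tensors gives the product of the contractions. -/
theorem satur_outer (A B T : Fin 3 → Fin 3 → ℝ) :
    satur (fun μ ν κ l => A μ ν * B κ l) T =
      (∑ ν, ∑ μ, A μ ν * T μ ν) * (∑ l, ∑ κ, B κ l * T κ l) := by
  simp only [satur, Fin.sum_univ_three]
  ring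

/-- Saturating a crossed product `A_{μκ} B_{νλ}` contracts each factor with one current. -/
theorem satur_cross (A B T : Fin 3 → Fin 3 → ℝ) :
    satur (fun μ ν κ l => A μ κ * B ν l) T =
      ∑ κ, ∑ ν, (∑ μ, A μ κ * T μ ν) * (∑ l, B ν l * T κ l) := by
  simp only [satur, Fin.sum_univ_three]
  ring

/-- For a symmetric current the last two indices of the saturated operator may be swapped. -/
theorem satur_swap (P : Tensor4) {T : Fin 3 → Fin 3 → ℝ} (hsymm : ∀ μ ν, T μ ν = T ν μ) :
    satur (fun μ ν κ l => P μ ν l κ) T = satur P T := by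
  unfold satur
  refine Finset.sum_congr rfl fun μ _ => Finset.sum_congr rfl fun ν _ => ?_
  rw [Finset.sum_comm]
  refine Finset.sum_congr rfl fun κ _ => Finset.sum_congr rfl fun l _ => ?_
  rw [hsymm l κ]

theorem eta_comm (μ ν : Fin 3) : eta μ ν = eta ν μ := by
  by_cases h : μ = ν
  · rw [h]
  · simp [eta, h, Ne.symm h]

theorem ωt_comm (k : Fin 3 → ℝ) (μ ν : Fin 3) : ωt k μ ν = ωt k ν μ := by
  simp only [ωt, mul_comm]

theorem θt_eq (k : Fin 3 → ℝ) (μ ν : Fin 3) : θt k μ ν = eta μ ν - ωt k μ ν := rfl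

theorem θt_comm (k : Fin 3 → ℝ) (μ ν : Fin 3) : θt k μ ν = θt k ν μ := by
  rw [θt_eq, θt_eq, eta_comm, ωt_comm]

section Conserved

variable {k : Fin 3 → ℝ} {T : Fin 3 → Fin 3 → ℝ}

theorem sum_ωt_mul (hcons : ∀ ν, ∑ μ, lowerIdx k μ * T μ ν = 0) (κ ν : Fin 3) :
    ∑ μ, ωt k μ κ * T μ ν = 0 := by
  calc ∑ μ, ωt k μ κ * T μ ν
      = lowerIdx k κ / ksq k * ∑ μ, lowerIdx k μ * T μ ν := by
        rw [Finset.mul_sum]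
        refine Finset.sum_congr rfl fun μ _ => ?_
        rw [ωt]
        ring
    _ = 0 := by rw [hcons, mul_zero]

theorem sum_θt_mul (hcons : ∀ ν, ∑ μ, lowerIdx k μ * T μ ν = 0) (κ ν : Fin 3) :
    ∑ μ, θt k μ κ * T μ ν = ∑ μ, eta μ κ * T μ ν := by
  simp only [θt_eq, sub_mul, Finset.sum_sub_distrib, sum_ωt_mul hcons, sub_zero]

theorem trT_eq (T : Fin 3 → Fin 3 → ℝ) : ∑ ν, ∑ μ, eta μ ν * T μ ν = trT T :=
  Finset.sum_comm

theorem satur_P0s (hcons : ∀ ν, ∑ μ, lowerIdx k μ * T μ ν = 0) :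
    satur (P0s k) T = 1 / 2 * trT T ^ 2 := by
  change satur ((1 / 2 : ℝ) • fun μ ν κ l => θt k μ ν * θt k κ l) T = _
  rw [satur_smul, satur_outer]
  simp only [sum_θt_mul hcons, trT_eq]
  ring

theorem satur_P0w (hcons : ∀ ν, ∑ μ, lowerIdx k μ * T μ ν = 0) : satur (P0w k) T = 0 := by
  unfold P0w
  rw [satur_outer]
  simp only [sum_ωt_mul hcons, Finset.sum_const_zero, zero_mul]

theorem satur_P0sw (hcons : ∀ ν, ∑ μ, lowerIdx k μ * T μ ν = 0) : satur (P0sw k) T = 0 := by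
  change satur ((1 / √2 : ℝ) • fun μ ν κ l => θt k μ ν * ωt k κ l) T = _
  rw [satur_smul, satur_outer]
  simp only [sum_ωt_mul hcons, Finset.sum_const_zero, mul_zero]

theorem satur_P0ws (hcons : ∀ ν, ∑ μ, lowerIdx k μ * T μ ν = 0) : satur (P0ws k) T = 0 := by
  change satur ((1 / √2 : ℝ) • fun μ ν κ l => ωt k μ ν * θt k κ l) T = _
  rw [satur_smul, satur_outer]
  simp only [sum_ωt_mul hcons, Finset.sum_const_zero, zero_mul, mul_zero]

theorem satur_cross_ωt_left (hcons : ∀ ν, ∑ μ, lowerIdx k μ * T μ ν = 0)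
    (B : Fin 3 → Fin 3 → ℝ) : satur (fun μ ν κ l => ωt k μ κ * B ν l) T = 0 := by
  rw [satur_cross]
  simp only [sum_ωt_mul hcons, zero_mul, Finset.sum_const_zero]

theorem satur_cross_ωt_right (hsymm : ∀ μ ν, T μ ν = T ν μ)
    (hcons : ∀ ν, ∑ μ, lowerIdx k μ * T μ ν = 0)
    (A : Fin 3 → Fin 3 → ℝ) : satur (fun μ ν κ l => A μ κ * ωt k ν l) T = 0 := by
  have h (ν κ : Fin 3) : ∑ l, ωt k ν l * T κ l = 0 := by
    simpa only [ωt_comm k ν, hsymm κ] using sum_ωt_mul hcons ν κ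
  rw [satur_cross]
  simp only [h, mul_zero, Finset.sum_const_zero]

theorem satur_P1 (hsymm : ∀ μ ν, T μ ν = T ν μ)
    (hcons : ∀ ν, ∑ μ, lowerIdx k μ * T μ ν = 0) : satur (P1 k) T = 0 := by
  have hP : P1 k = (1 / 2 : ℝ) • ((fun μ ν κ l => θt k μ κ * ωt k ν l) +
      (fun μ ν κ l => θt k μ l * ωt k ν κ) + (fun μ ν κ l => ωt k μ κ * θt k ν l) +
      (fun μ ν κ l => ωt k μ l * θt k ν κ)) := by
    funext μ ν κ l
    simp only [P1, Pi.smul_apply, Pi.add_apply, smul_eq_mul]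
    ring
  rw [hP, satur_smul, satur_add, satur_add, satur_add,
    satur_swap (fun μ ν κ l => θt k μ κ * ωt k ν l) hsymm,
    satur_swap (fun μ ν κ l => ωt k μ κ * θt k ν l) hsymm,
    satur_cross_ωt_left hcons, satur_cross_ωt_right hsymm hcons]
  ring

theorem satur_cross_θt (hsymm : ∀ μ ν, T μ ν = T ν μ)
    (hcons : ∀ ν, ∑ μ, lowerIdx k μ * T μ ν = 0) :
    satur (fun μ ν κ l => θt k μ κ * θt k ν l) T = Tsq T := by
  have h (ν κ : Fin 3) : ∑ l, θt k ν l * T κ l = ∑ l, eta ν l * T κ l := by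
    simpa only [θt_comm k ν, eta_comm ν, hsymm κ] using sum_θt_mul hcons ν κ
  rw [satur_cross]
  simp only [h, sum_θt_mul hcons]
  rw [← satur_cross, satur, Tsq]
  refine Finset.sum_congr rfl fun μ _ => Finset.sum_congr rfl fun ν _ =>
    Finset.sum_congr rfl fun κ _ => Finset.sum_congr rfl fun l _ => ?_
  ring

theorem satur_P2 (hsymm : ∀ μ ν, T μ ν = T ν μ)
    (hcons : ∀ ν, ∑ μ, lowerIdx k μ * T μ ν = 0) :
    satur (P2 k) T = Tsq T - 1 / 2 * trT T ^ 2 := by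
  have hP : P2 k = (1 / 2 : ℝ) • ((fun μ ν κ l => θt k μ κ * θt k ν l) +
      (fun μ ν κ l => θt k μ l * θt k ν κ)) + (-1 : ℝ) • P0s k := by
    funext μ ν κ l
    simp only [P2, P0s, Pi.smul_apply, Pi.add_apply, smul_eq_mul]
    ring
  rw [hP, satur_add, satur_smul, satur_smul, satur_add,
    satur_swap (fun μ ν κ l => θt k μ κ * θt k ν l) hsymm,
    satur_cross_θt hsymm hcons, satur_P0s hcons]
  ring

end Conserved

/-- Partial fractions of the scalar coefficient of a massive mode of squared mass `-s / c`. -/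
theorem inv_mul_add_eq_partial_fractions {s c x m : ℝ} (hs : s ≠ 0) (hc : c ≠ 0) (hx : x ≠ 0)
    (hm : m = -s / c) (hxm : x ≠ m) :
    (x * (s + c * x))⁻¹ = 1 / s * (1 / x - 1 / (x - m)) := by
  have hsub : x - m = (s + c * x) / c := by
    rw [hm]
    field_simp
    ring
  have hne : s + c * x ≠ 0 := fun h => hxm (sub_eq_zero.mp (by rw [hsub, h, zero_div]))
  rw [hsub, one_div_div, div_sub_div _ _ hx hne, inv_eq_one_div, div_mul_div_comm,
    div_eq_div_iff (mul_ne_zero hx hne) (mul_ne_zero hs (mul_ne_zero hx hne))]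
  ring

/-- The saturated propagator of general higher-derivative 3D gravity. -/
theorem saturated_propagator_general (σ α β κ Λ : ℝ)
    (hσ : σ ≠ 0) (hβ : β ≠ 0) (hαβ : 8 * α + 3 * β ≠ 0) (hκ : κ ≠ 0) (hΛ : Λ ≠ 0)
    (m2sq m0sq : ℝ) (hm2 : m2sq = -4 * σ / (β * κ^2))
    (hm0 : m0sq = 4 * σ / ((8 * α + 3 * β) * κ^2))
    (k : Fin 3 → ℝ) (hk : ksq k ≠ 0) (hk2 : ksq k ≠ m2sq) (hk0 : ksq k ≠ m0sq)
    (T : Fin 3 → Fin 3 → ℝ) (hsymm : ∀ μ ν, T μ ν = T ν μ)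
    (hcons : ∀ ν, ∑ μ, lowerIdx k μ * T μ ν = 0)
    (Oinv : Tensor4)
    (hOinv : Oinv = (2 * Λ / ksq k) • P1 k +
      (ksq k * (σ + β * κ^2 * ksq k / 4))⁻¹ • P2 k +
      (-σ * ksq k + 2 * α * κ^2 * (ksq k)^2 + (3/4) * β * κ^2 * (ksq k)^2)⁻¹ • P0s k +
      (Real.sqrt 2 *
        (-σ * ksq k + 2 * α * κ^2 * (ksq k)^2 + (3/4) * β * κ^2 * (ksq k)^2)⁻¹) •
        (P0sw k + P0ws k) +
      ((-4 * Λ * σ + 2 + 8 * Λ * α * κ^2 * ksq k + 3 * Λ * β * κ^2 * ksq k) *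
        (-σ * ksq k + 2 * α * κ^2 * (ksq k)^2 + (3/4) * β * κ^2 * (ksq k)^2)⁻¹) • P0w k) :
    satur Oinv T =
      (1/σ) * (1 / ksq k - 1 / (ksq k - m2sq)) * (Tsq T - (1/2) * (trT T)^2) +
      (1/σ) * (-(1 / ksq k) + 1 / (ksq k - m0sq)) * ((1/2) * (trT T)^2) := by
  have h2 := inv_mul_add_eq_partial_fractions (c := β * κ ^ 2 / 4) hσ (by positivity) hk
    (by rw [hm2]; field_simp) hk2
  have h0 := inv_mul_add_eq_partial_fractions (c := (8 * α + 3 * β) * κ ^ 2 / 4)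
    (neg_ne_zero.mpr hσ) (by positivity) hk (by rw [hm0]; field_simp) hk0
  have e2 : ksq k * (σ + β * κ ^ 2 * ksq k / 4) = ksq k * (σ + β * κ ^ 2 / 4 * ksq k) := by ring
  have e0 : -σ * ksq k + 2 * α * κ ^ 2 * ksq k ^ 2 + 3 / 4 * β * κ ^ 2 * ksq k ^ 2 =
      ksq k * (-σ + (8 * α + 3 * β) * κ ^ 2 / 4 * ksq k) := by ring
  rw [hOinv, e2, e0, h2, h0]
  simp only [satur_add, satur_smul, satur_P1 hsymm hcons, satur_P2 hsymm hcons, satur_P0s hcons,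
    satur_P0sw hcons, satur_P0ws hcons, satur_P0w hcons]
  ring
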